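/- arXiv:1606.08115 — 2 statements merged into one kernel-verified Lean document; each statement's English description precedes it below -/
import Mathlib

section
/- Let m ≥ n ≥ 1, let X be a Zariski-closed algebraic subvariety of ℂ^m, and let f : X → ℂ^n be a polynomial map, i.e., the restriction to X of a map ℂ^m → ℂ^n all of whose component functions are polynomials. Then there exists a polynomial map F : ℂ^m → ℂ^n extending f (F restricted to X equals f) such that for every z ∈ ℂ^n the set F^{-1}(z) ∖ X has dimension at most m − n. -/
open MvPolynomial

/-- A subset of `ℂ^m` is Zariski-closed if it is the common zero locus of a
family of polynomials in `m` variables. -/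
def ZariskiClosed {m : ℕ} (X : Set (Fin m → ℂ)) : Prop :=
  ∃ S : Set (MvPolynomial (Fin m) ℂ), X = {x | ∀ p ∈ S, eval x p = 0}

/-- A subset of `ℂ^m` is Zariski-open if its complement is Zariski-closed. -/
def ZariskiOpen {m : ℕ} (U : Set (Fin m → ℂ)) : Prop :=
  ZariskiClosed Uᶜ

/-- The Zariski closure of a subset of `ℂ^m`: the intersection of all
Zariski-closed sets containing it. -/
def zariskiClosure {m : ℕ} (X : Set (Fin m → ℂ)) : Set (Fin m → ℂ) :=
  ⋂₀ {C | ZariskiClosed C ∧ X ⊆ C}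

/-- A Zariski-closed set is irreducible if it is nonempty and is not covered by
two Zariski-closed sets unless it is contained in one of them. -/
def ZariskiIrreducible {m : ℕ} (C : Set (Fin m → ℂ)) : Prop :=
  C.Nonempty ∧ ∀ C₁ C₂ : Set (Fin m → ℂ), ZariskiClosed C₁ → ZariskiClosed C₂ →
    C ⊆ C₁ ∪ C₂ → (C ⊆ C₁ ∨ C ⊆ C₂)

/-- The dimension of a subset of `ℂ^m`: the Krull dimension of its Zariski
closure, i.e. the supremum of lengths of strictly increasing chains of
irreducible Zariski-closed subsets contained in the closure. -/
noncomputable def zariskiDim {m : ℕ} (X : Set (Fin m → ℂ)) : WithBot ℕ∞ :=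
  Order.krullDim {C : Set (Fin m → ℂ) //
    ZariskiClosed C ∧ ZariskiIrreducible C ∧ C ⊆ zariskiClosure X}

/-- A map `ℂ^m → ℂ^n` is a polynomial map if all its component functions are
polynomials. -/
def IsPolynomialMap {m n : ℕ} (f : (Fin m → ℂ) → (Fin n → ℂ)) : Prop :=
  ∃ P : Fin n → MvPolynomial (Fin m) ℂ, ∀ x i, f x i = eval x (P i)

theorem AlgebraicIndependent.card_le_of_mem_adjoin {k E ι κ : Type*} [Field k] [Field E]
    [Algebra k E] [Fintype ι] [Fintype κ] {v : ι → E} (hv : AlgebraicIndependent k v) (w : κ → E)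
    (h : ∀ i, v i ∈ IntermediateField.adjoin k (Set.range w)) :
    Fintype.card ι ≤ Fintype.card κ := by
  let M := AlgebraicIndependent.matroid k E
  have hind : M.Indep (Set.range v) :=
    AlgebraicIndependent.matroid_indep_iff.mpr hv.to_subtype_range
  have hsub : Set.range v ⊆ M.closure (Set.range w) := by
    rintro _ ⟨i, rfl⟩
    rw [AlgebraicIndependent.matroid_closure_eq]
    change IsAlgebraic _ _
    refine IntermediateField.adjoin_induction k
      (p := fun x _ ↦ IsAlgebraic (Algebra.adjoin k (Set.range w)) x) ?_ ?_ ?_ ?_ ?_ (h i)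
    · exact fun x hx ↦ isAlgebraic_algebraMap
        (⟨x, Algebra.subset_adjoin hx⟩ : Algebra.adjoin k (Set.range w))
    · exact fun x ↦ isAlgebraic_algebraMap
        (algebraMap k (Algebra.adjoin k (Set.range w)) x)
    · exact fun x y _ _ hx hy ↦ hx.add hy
    · exact fun x _ hx ↦ hx.inv
    · exact fun x y _ _ hx hy ↦ hx.mul hy
  have h1 := hind.encard_le_eRk_of_subset hsub
  rw [M.eRk_closure_eq] at h1
  have h2 := h1.trans (M.eRk_le_encard _)
  have h3 : (Set.range w).encard ≤ Fintype.card κ := by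
    rw [← Set.image_univ]
    refine (Set.encard_image_le _ _).trans ?_
    simp
  have h4 : (Set.range v).encard = Fintype.card ι := by
    rw [← Set.image_univ, hv.injective.encard_image]
    simp
  rw [h4] at h2
  exact_mod_cast h2.trans h3

theorem exists_algebraicIndependent_complex (k ι : Type) [Field k] [Countable k] [Finite ι]
    [Algebra k ℂ] : ∃ y : ι → ℂ, AlgebraicIndependent k y := by
  obtain ⟨s, hs⟩ := exists_isTranscendenceBasis k ℂ
  have h := IsAlgClosed.cardinal_le_max_transcendence_basis' _ hs
  have hinf : Infinite s := by
    by_contra hfin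
    rw [not_infinite_iff_finite] at hfin
    refine absurd (h.trans (max_le (max_le ?_ ?_) le_rfl)) ?_
    · exact Cardinal.mk_le_aleph0
    · exact Cardinal.mk_le_aleph0
    · rw [not_le, Cardinal.mk_complex]
      exact Cardinal.aleph0_lt_continuum
  let e : ι ↪ s := ((Finite.equivFin ι).toEmbedding.trans Fin.valEmbedding).trans
    (Infinite.natEmbedding s)
  exact ⟨_, hs.1.comp e e.injective⟩

theorem IsTranscendenceBasis.exists_injective_algHom {k L K ι : Type*} [Field k] [CommRing L]
    [IsDomain L] [Field K] [IsAlgClosed K] [Algebra k L] [Algebra k K] {t : ι → L}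
    (ht : IsTranscendenceBasis k t) {y : ι → K} (hy : AlgebraicIndependent k y) :
    ∃ φ : L →ₐ[k] K, Function.Injective φ ∧ ∀ i, φ (t i) = y i := by
  let S := Algebra.adjoin k (Set.range t)
  let ψ : S →ₐ[k] K := (aeval y).comp ht.1.aevalEquiv.symm.toAlgHom
  have hψ : Function.Injective ψ := by
    refine Function.Injective.comp (g := aeval y) hy ht.1.aevalEquiv.symm.injective
  let : Algebra S K := ψ.toRingHom.toAlgebra
  have : IsScalarTower k S K := .of_algebraMap_eq fun x ↦ (ψ.commutes x).symm
  have : Algebra.IsAlgebraic S L := ht.isAlgebraic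
  have : FaithfulSMul S K := (faithfulSMul_iff_algebraMap_injective S K).mpr hψ
  have : Module.IsTorsionFree S K := Module.isTorsionFree_iff_faithfulSMul.mpr this
  have : Module.IsTorsionFree S L := Module.isTorsionFree_iff_faithfulSMul.mpr inferInstance
  let φ : L →ₐ[S] K := IsAlgClosed.lift (R := S) (S := L) (M := K)
  refine ⟨φ.restrictScalars k, ?_, fun i ↦ ?_⟩
  · rw [injective_iff_map_eq_zero]
    intro a ha
    by_contra hne
    refine Ideal.comap_ne_bot_of_algebraic_mem (R := S) (I := RingHom.ker φ) hne ha
      (Algebra.IsAlgebraic.isAlgebraic a) ?_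
    rw [eq_bot_iff]
    intro r hr
    have hr' : φ (algebraMap S L r) = 0 := hr
    rw [φ.commutes] at hr'
    exact hψ (hr'.trans (map_zero ψ).symm)
  · let ti : S := ⟨t i, Algebra.subset_adjoin ⟨i, rfl⟩⟩
    have h1 : φ (t i) = ψ ti := φ.commutes ti
    have h2 : ht.1.aevalEquiv (X i) = ti := by
      apply Subtype.ext; simp [ti]
    change φ (t i) = y i
    rw [h1, ← h2]
    simp [ψ]

theorem AlgebraicIndependent.exists_specializations {k D : Type} [Field k] [Countable k]
    [Algebra k ℂ] [CommRing D] [IsDomain D] [Algebra k D] {m d : ℕ} (ξ : Fin m → D)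
    (e : Fin d → Fin m) (he : AlgebraicIndependent k (ξ ∘ e)) (s : ℕ) :
    ∃ x : Fin s → Fin m → ℂ,
      (∀ j (p : MvPolynomial (Fin m) k), aeval (x j) p = 0 ↔ aeval ξ p = 0) ∧
      AlgebraicIndependent k (fun ji : Fin s × Fin d ↦ x ji.1 (e ji.2)) := by
  let L := Algebra.adjoin k (Set.range ξ)
  let ξ' : Fin m → L := fun i ↦ ⟨ξ i, Algebra.subset_adjoin ⟨i, rfl⟩⟩
  have hval (p : MvPolynomial (Fin m) k) : aeval ξ p = L.val (aeval ξ' p) := by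
    rw [← AlgHom.comp_apply, comp_aeval]; rfl
  have he' : AlgebraicIndependent k (ξ' ∘ e) := he.of_comp L.val
  have htop : Algebra.adjoin k (Set.range ξ') = ⊤ := by
    rw [eq_top_iff]
    rintro ⟨a, ha⟩ -
    have ha' : a ∈ Algebra.adjoin k (Set.range ξ) := ha
    rw [Algebra.adjoin_range_eq_range_aeval] at ha' ⊢
    obtain ⟨p, hp⟩ := ha'
    exact ⟨p, Subtype.ext ((hval p).symm.trans hp)⟩
  have : Algebra.IsAlgebraic (Algebra.adjoin k (Set.range ξ')) L :=
    ⟨fun a ↦ isAlgebraic_algebraMap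
      (⟨a, htop ▸ Algebra.mem_top⟩ : Algebra.adjoin k (Set.range ξ'))⟩
  obtain ⟨u, hu₁, hu₂, hu⟩ := exists_isTranscendenceBasis_between (R := k)
    (Set.range (ξ' ∘ e)) (Set.range ξ') (Set.range_comp_subset_range _ _) he'.to_subtype_range
  have : Finite u := (Set.finite_range ξ').subset hu₂
  obtain ⟨y, hy⟩ := exists_algebraicIndependent_complex k (Fin s × u)
  have hy' (j : Fin s) : AlgebraicIndependent k (fun a : u ↦ y (j, a)) :=
    hy.comp (fun a ↦ (j, a)) (Prod.mk_right_injective j)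
  choose φ hφ hφy using fun j ↦ hu.exists_injective_algHom (hy' j)
  refine ⟨fun j i ↦ φ j (ξ' i), fun j p ↦ ?_, ?_⟩
  · have : aeval (fun i ↦ φ j (ξ' i)) p = φ j (aeval ξ' p) := by
      rw [← AlgHom.comp_apply, comp_aeval]
    rw [this, hval, map_eq_zero_iff _ (hφ j)]
    simp
  · let c : Fin d → u := fun i ↦ ⟨ξ' (e i), hu₁ ⟨i, rfl⟩⟩
    have hc : Function.Injective c := fun a b hab ↦ he'.injective (congrArg Subtype.val hab)
    have := hy.comp (Prod.map id c) (Function.injective_id.prodMap hc)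
    convert this using 2 with ji
    exact hφy ji.1 (c ji.2)

theorem mem_of_sum_mul_pow_mem {k E : Type*} [Field k] [Field E] [Algebra k E]
    (K : IntermediateField k E) {s : ℕ} {t : Fin s → E} (ht : ∀ j, t j ∈ K)
    (hinj : Function.Injective t) {a : Fin s → E} (h : ∀ j, ∑ e, a e * t j ^ (e : ℕ) ∈ K)
    (e : Fin s) : a e ∈ K := by
  let t' : Fin s → K := fun j ↦ ⟨t j, ht j⟩
  let b' : Fin s → K := fun j ↦ ⟨_, h j⟩
  have ht' : Function.Injective t' := fun i j hij ↦ hinj (congrArg Subtype.val hij)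
  have hdet : IsUnit (Matrix.vandermonde t').det :=
    (Matrix.det_vandermonde_ne_zero_iff.mpr ht').isUnit
  let a' := (Matrix.vandermonde t')⁻¹.mulVec b'
  have ha' : (Matrix.vandermonde t').mulVec a' = b' := by
    simp [a', Matrix.mulVec_mulVec, Matrix.mul_nonsing_inv _ hdet]
  have hz : (fun e ↦ a e - (a' e : E)) = 0 := by
    refine Matrix.eq_zero_of_mulVec_eq_zero (Matrix.det_vandermonde_ne_zero_iff.mpr hinj) ?_
    ext j
    have hj := congrArg Subtype.val (congrFun ha' j)
    simp only [Matrix.mulVec, dotProduct, Matrix.vandermonde_apply, b', t',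
      AddSubmonoidClass.coe_finsetSum, MulMemClass.coe_mul, SubmonoidClass.coe_pow] at hj
    simp only [Matrix.mulVec, dotProduct, Matrix.vandermonde_apply, mul_sub,
      Finset.sum_sub_distrib, hj, Pi.zero_apply, sub_eq_zero]
    exact Finset.sum_congr rfl fun _ _ ↦ mul_comm _ _
  have := congrFun hz e
  simp only [Pi.zero_apply, sub_eq_zero] at this
  rw [this]
  exact (a' e).2

theorem exists_countable_subfield_mem_range_map {ι σ : Type*} [Countable ι]
    (p : ι → MvPolynomial σ ℂ) : ∃ k : Subfield ℂ, Countable k ∧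
      ∀ i, p i ∈ (map (σ := σ) (algebraMap k ℂ)).range := by
  let S : Set ℂ := ⋃ i, ((p i).coeffs : Set ℂ)
  have hS : S.Countable := Set.countable_iUnion fun i ↦ Finset.countable_toSet _
  refine ⟨Subfield.closure S, ?_, fun i ↦ ?_⟩
  · rw [← Cardinal.mk_le_aleph0_iff]
    exact (Subfield.cardinalMk_closure_le_max S).trans (max_le hS.le_aleph0 le_rfl)
  · refine mem_range_map_iff_coeffs_subset.mpr fun c hc ↦ ?_
    exact ⟨⟨c, Subfield.subset_closure (Set.mem_iUnion.mpr ⟨i, hc⟩)⟩, rfl⟩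

theorem IntermediateField.aeval_mem {k E σ : Type*} [Field k] [Field E] [Algebra k E]
    (K : IntermediateField k E) {x : σ → E} (hx : ∀ i, x i ∈ K) (p : MvPolynomial σ k) :
    aeval x p ∈ K := by
  have : aeval x p = K.val (aeval (fun i ↦ (⟨x i, hx i⟩ : K)) p) := by
    rw [← AlgHom.comp_apply, comp_aeval]; rfl
  rw [this]
  exact Subtype.prop _

theorem exists_generic_perturbation {m n r : ℕ} (f : Fin n → MvPolynomial (Fin m) ℂ)
    (g : Fin r → MvPolynomial (Fin m) ℂ) :
    ∃ F : Fin n → MvPolynomial (Fin m) ℂ, (∀ i, F i - f i ∈ Ideal.span (Set.range g)) ∧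
      ∀ (D : Type) [CommRing D] [IsDomain D] [Algebra ℂ D] (ξ : Fin m → D) (z : Fin n → ℂ)
        (d : ℕ) (e : Fin d → Fin m), 0 < d → (∀ i, aeval ξ (F i) = algebraMap ℂ D (z i)) →
        (∃ ρ, aeval ξ (g ρ) ≠ 0) → AlgebraicIndependent ℂ (ξ ∘ e) → d + n ≤ m := by
  obtain ⟨k₀, hk₀, hfg⟩ := exists_countable_subfield_mem_range_map (Sum.elim f g)
  have hf (i) : f i ∈ (map (σ := Fin m) (algebraMap k₀ ℂ)).range := hfg (.inl i)
  have hg (i) : g i ∈ (map (σ := Fin m) (algebraMap k₀ ℂ)).range := hfg (.inr i)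
  obtain ⟨A, hA⟩ := exists_algebraicIndependent_complex k₀
    (Fin n × (Fin r × Fin m) × Fin (n + 1))
  let F : Fin n → MvPolynomial (Fin m) ℂ := fun i ↦
    f i + ∑ b : Fin r × Fin m, ∑ l : Fin (n + 1), C (A (i, b, l)) * X b.2 ^ (l : ℕ) * g b.1
  refine ⟨F, fun i ↦ ?_, ?_⟩
  · simp only [F, add_sub_cancel_left]
    exact sum_mem fun b _ ↦ sum_mem fun l _ ↦
      Ideal.mul_mem_left _ _ (Ideal.subset_span ⟨b.1, rfl⟩)
  intro D _ _ _ ξ z d e hd hF ⟨ρ, hρ⟩ hind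
  let k₁ := IntermediateField.adjoin k₀ (Set.range A ∪ Set.range z)
  have hk₁ : Countable k₁ := by
    rw [← Cardinal.mk_le_aleph0_iff]
    refine (IntermediateField.cardinalMk_adjoin_le k₀ _).trans (max_le (max_le ?_ ?_) le_rfl)
    · exact Cardinal.mk_le_aleph0
    · exact ((Set.countable_range A).union (Set.countable_range z)).le_aleph0
  obtain ⟨x, hx, hy⟩ := (hind.restrictScalars (R := k₁)
    (FaithfulSMul.algebraMap_injective k₁ ℂ)).exists_specializations ξ e (n + 1)
  let Q := (map (σ := Fin m) (algebraMap k₁ ℂ)).range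
  have htransfer {q : MvPolynomial (Fin m) ℂ} (hq : q ∈ Q) (j : Fin (n + 1)) :
      eval (x j) q = 0 ↔ aeval ξ q = 0 := by
    obtain ⟨p, rfl⟩ := hq
    have h (y : Fin m → ℂ) : eval y (map (algebraMap k₁ ℂ) p) = aeval y p := by
      rw [eval_map, aeval_def]
    change eval (x j) (map _ p) = 0 ↔ aeval ξ (map _ p) = 0
    rw [h, aeval_map_algebraMap]
    exact hx j p
  have hQ {q : MvPolynomial (Fin m) ℂ} (hq : q ∈ (map (σ := Fin m) (algebraMap k₀ ℂ)).range) :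
      q ∈ Q := by
    obtain ⟨p, rfl⟩ := hq
    exact ⟨map (algebraMap k₀ k₁) p, by rw [map_map, ← IsScalarTower.algebraMap_eq]⟩
  have hQC {c : ℂ} (hc : c ∈ k₁) : C c ∈ Q := ⟨C ⟨c, hc⟩, by rw [map_C]; rfl⟩
  have hAk₁ (a) : A a ∈ k₁ := IntermediateField.subset_adjoin _ _ (.inl ⟨a, rfl⟩)
  have hzk₁ (i) : z i ∈ k₁ := IntermediateField.subset_adjoin _ _ (.inr ⟨i, rfl⟩)
  have hFx (i) (j) : eval (x j) (F i) = z i := by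
    have hFQ : F i - C (z i) ∈ Q := by
      refine sub_mem (add_mem (hQ (hf i)) (sum_mem fun b _ ↦ sum_mem fun l _ ↦ ?_))
        (hQC (hzk₁ i))
      have hXQ : X b.2 ∈ Q := ⟨X b.2, map_X _ _⟩
      exact mul_mem (mul_mem (hQC (hAk₁ _)) (pow_mem hXQ _)) (hQ (hg _))
    have := (htransfer hFQ j).mpr (by rw [map_sub, hF, aeval_C, sub_self])
    simpa [sub_eq_zero] using this
  have hgx (j) : eval (x j) (g ρ) ≠ 0 := (htransfer (hQ (hg ρ)) j).not.mpr hρ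
  let b₀ : Fin r × Fin m := (ρ, e ⟨0, hd⟩)
  let w : (Fin (n + 1) × Fin m) ⊕ Fin n ⊕ (Fin n × {b // b ≠ b₀} × Fin (n + 1)) → ℂ :=
    Sum.elim (fun a ↦ x a.1 a.2) (Sum.elim z fun a ↦ A (a.1, a.2.1, a.2.2))
  let K := IntermediateField.adjoin k₀ (Set.range w)
  have hwK (a) : w a ∈ K := IntermediateField.subset_adjoin _ _ ⟨a, rfl⟩
  have hxK (j) (i) : x j i ∈ K := hwK (.inl (j, i))
  have hzK (i) : z i ∈ K := hwK (.inr (.inl i))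
  have hAK (i) (b) (hb : b ≠ b₀) (l) : A (i, b, l) ∈ K := hwK (.inr (.inr (i, ⟨b, hb⟩, l)))
  have hevK (j) {q : MvPolynomial (Fin m) ℂ}
      (hq : q ∈ (map (σ := Fin m) (algebraMap k₀ ℂ)).range) : eval (x j) q ∈ K := by
    obtain ⟨p, rfl⟩ := hq
    simpa [eval_map, aeval_def] using K.aeval_mem (hxK j) p
  have hAK₀ (i) (l) : A (i, b₀, l) ∈ K := by
    refine mem_of_sum_mul_pow_mem K (t := fun j ↦ x j b₀.2) (fun j ↦ hxK j _) ?_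
      (a := fun l ↦ A (i, b₀, l)) (fun j ↦ ?_) l
    · exact (hy.comp (fun j ↦ (j, ⟨0, hd⟩)) (Prod.mk_left_injective _)).injective
    have hj := hFx i j
    simp only [F, map_add, map_sum, map_mul, map_pow, eval_C, eval_X] at hj
    rw [← Finset.add_sum_erase _ _ (Finset.mem_univ b₀), ← Finset.sum_mul] at hj
    have hrest : ∑ b ∈ Finset.univ.erase b₀, ∑ l : Fin (n + 1),
        A (i, b, l) * x j b.2 ^ (l : ℕ) * eval (x j) (g b.1) ∈ K :=
      sum_mem fun b hb ↦ sum_mem fun l _ ↦ mul_mem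
        (mul_mem (hAK i b (Finset.ne_of_mem_erase hb) l) (pow_mem (hxK _ _) _)) (hevK j (hg _))
    have hsolve : ∑ l : Fin (n + 1), A (i, b₀, l) * x j b₀.2 ^ (l : ℕ) =
        (z i - eval (x j) (f i) - ∑ b ∈ Finset.univ.erase b₀, ∑ l : Fin (n + 1),
          A (i, b, l) * x j b.2 ^ (l : ℕ) * eval (x j) (g b.1)) / eval (x j) (g ρ) := by
      rw [eq_div_iff (hgx j), ← hj]
      ring
    rw [hsolve]
    exact div_mem (sub_mem (sub_mem (hzK i) (hevK j (hf i))) hrest) (hevK j (hg ρ))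
  have hv := hA.sumElim_of_tower (S := k₁)
    (by rintro _ ⟨a, rfl⟩; exact ⟨⟨A a, hAk₁ a⟩, rfl⟩) hy
  have hcard := hv.card_le_of_mem_adjoin w (by
    rintro (⟨j, i⟩ | ⟨i, b, l⟩)
    · exact hxK j _
    · by_cases hb : b = b₀
      · subst hb; exact hAK₀ i l
      · exact hAK i b hb l)
  have hb : Fintype.card {b // b ≠ b₀} + 1 = r * m := by
    have := Fintype.card_subtype_compl (fun b ↦ b = b₀)
    have hpos : 0 < Fintype.card (Fin r × Fin m) := Fintype.card_pos_iff.mpr ⟨b₀⟩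
    simp only [Fintype.card_unique, Fintype.card_prod, Fintype.card_fin] at this hpos
    change Fintype.card {b // ¬ b = b₀} + 1 = r * m
    omega
  simp only [Fintype.card_sum, Fintype.card_prod, Fintype.card_fin, ← hb] at hcard
  by_contra! hlt
  have : (n + 1) * (m + 1) ≤ (n + 1) * (d + n) := Nat.mul_le_mul_left _ hlt
  nlinarith

theorem ringKrullDim_le_of_isIntegral {R S : Type*} [CommRing R] [CommRing S] [Algebra R S]
    [Algebra.IsIntegral R S] : ringKrullDim S ≤ ringKrullDim R :=
  Order.krullDim_le_of_strictMono (PrimeSpectrum.comap (algebraMap R S))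
    fun I _ hIJ ↦ Ideal.IsIntegral.comap_lt_comap (I := I.asIdeal) hIJ

theorem exists_algebraicIndependent_and_ringKrullDim_quotient_le {k : Type} [Field k] {m : ℕ}
    (P : Ideal (MvPolynomial (Fin m) k)) [hP : P.IsPrime] :
    ∃ (d : ℕ) (e : Fin d → Fin m),
      AlgebraicIndependent k ((fun i ↦ Ideal.Quotient.mk P (X i)) ∘ e) ∧
      ringKrullDim (MvPolynomial (Fin m) k ⧸ P) ≤ d := by
  let D := MvPolynomial (Fin m) k ⧸ P
  let ξ : Fin m → D := fun i ↦ Ideal.Quotient.mk P (X i)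
  obtain ⟨d, -, φ, hφ, hint⟩ := exists_integral_inj_algHom_of_quotient P hP.ne_top
  have htop : Algebra.adjoin k (Set.range ξ) = ⊤ := by
    rw [eq_top_iff, Algebra.adjoin_range_eq_range_aeval]
    rintro a -
    obtain ⟨p, rfl⟩ := Ideal.Quotient.mk_surjective a
    refine ⟨p, ?_⟩
    change aeval ξ p = Ideal.Quotient.mkₐ k P p
    congr 1
    ext i
    exact aeval_X ξ i
  have : Algebra.IsAlgebraic (Algebra.adjoin k (Set.range ξ)) D :=
    ⟨fun a ↦ isAlgebraic_algebraMap
      (⟨a, htop ▸ Algebra.mem_top⟩ : Algebra.adjoin k (Set.range ξ))⟩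
  obtain ⟨u, hu, hbasis⟩ := exists_isTranscendenceBasis_subset (R := k) (Set.range ξ)
  have hind : AlgebraicIndependent k (fun i : Fin d ↦ φ (X i)) :=
    (algebraicIndependent_X (Fin d) k).map' hφ
  have hcard : Cardinal.mk (Fin d) ≤ Cardinal.mk u := by
    rw [hbasis.cardinalMk_eq_trdeg]
    exact hind.cardinalMk_le_trdeg
  obtain ⟨ι⟩ := (Cardinal.le_def _ _).mp hcard
  choose e he using fun i ↦ hu (ι i).2
  refine ⟨d, e, ?_, ?_⟩
  · convert hbasis.1.comp ι ι.injective using 1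
    exact funext he
  · let : Algebra (MvPolynomial (Fin d) k) D := φ.toRingHom.toAlgebra
    have : Algebra.IsIntegral (MvPolynomial (Fin d) k) D := ⟨hint⟩
    refine (ringKrullDim_le_of_isIntegral (R := MvPolynomial (Fin d) k)).trans ?_
    simp

theorem ZariskiClosed.zeroLocus_vanishingIdeal {m : ℕ} {V : Set (Fin m → ℂ)}
    (hV : ZariskiClosed V) : zeroLocus ℂ (vanishingIdeal ℂ V) = V := by
  refine subset_antisymm ?_ (zeroLocus_vanishingIdeal_le V)
  obtain ⟨S, rfl⟩ := hV
  exact fun x hx p hp ↦ hx p fun y hy ↦ hy p hp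

theorem zariskiClosed_setOf_eval_eq_zero {m : ℕ} (p : MvPolynomial (Fin m) ℂ) :
    ZariskiClosed {x | eval x p = 0} := ⟨{p}, by simp⟩

theorem ZariskiIrreducible.isPrime_vanishingIdeal {m : ℕ} {V : Set (Fin m → ℂ)}
    (hV : ZariskiIrreducible V) : (vanishingIdeal ℂ V).IsPrime := by
  refine Ideal.isPrime_iff.mpr ⟨fun h ↦ ?_, fun {p q} hpq ↦ ?_⟩
  · obtain ⟨x, hx⟩ := hV.1
    have h1 : (1 : MvPolynomial (Fin m) ℂ) ∈ vanishingIdeal ℂ V := h ▸ Submodule.mem_top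
    simpa using h1 x hx
  · refine hV.2 _ _ (zariskiClosed_setOf_eval_eq_zero p) (zariskiClosed_setOf_eval_eq_zero q) ?_
    intro x hx
    exact mul_eq_zero.mp ((map_mul (eval x) p q).symm.trans (hpq x hx))

theorem vanishingIdeal_zariskiClosure {m : ℕ} (Y : Set (Fin m → ℂ)) :
    vanishingIdeal ℂ (zariskiClosure Y) = vanishingIdeal ℂ Y := by
  refine le_antisymm (vanishingIdeal_anti_mono fun x hx ↦ ?_) fun p hp x hx ↦ ?_
  · exact Set.mem_sInter.mpr fun C hC ↦ hC.2 hx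
  · exact Set.mem_sInter.mp hx _ ⟨zariskiClosed_setOf_eval_eq_zero p, hp⟩

theorem zariskiDim_le_of_forall_exists_prime {m : ℕ} {Y : Set (Fin m → ℂ)} {N : WithBot ℕ∞}
    (h : ∀ Q : Ideal (MvPolynomial (Fin m) ℂ), Q.IsPrime → vanishingIdeal ℂ Y ≤ Q →
      ∃ P ≤ Q, ringKrullDim (MvPolynomial (Fin m) ℂ ⧸ P) ≤ N) :
    zariskiDim Y ≤ N := by
  rw [zariskiDim, Order.krullDim_eq_iSup_height]
  refine iSup_le fun ⟨V, hVc, hVi, hVY⟩ ↦ ?_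
  obtain ⟨P, hPQ, hPN⟩ := h (vanishingIdeal ℂ V) hVi.isPrime_vanishingIdeal
    ((vanishingIdeal_zariskiClosure Y).symm.trans_le (vanishingIdeal_anti_mono hVY))
  refine le_trans ?_ hPN
  rw [Order.height_eq_krullDim_Iic, ringKrullDim_quotient, ← Order.krullDim_orderDual]
  refine Order.krullDim_le_of_strictMono (fun W ↦
    (⟨⟨vanishingIdeal ℂ W.ofDual.1.1, W.ofDual.1.2.2.1.isPrime_vanishingIdeal⟩,
      hPQ.trans (vanishingIdeal_anti_mono W.ofDual.2)⟩ :
        PrimeSpectrum.zeroLocus (P : Set (MvPolynomial (Fin m) ℂ)))) ?_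
  intro W₁ W₂ hW
  have hW' : W₂.ofDual < W₁.ofDual := hW
  refine lt_of_le_not_ge (vanishingIdeal_anti_mono hW'.le) fun h ↦ hW'.not_ge ?_
  change W₁.ofDual.1.1 ⊆ W₂.ofDual.1.1
  rw [← W₁.ofDual.1.2.1.zeroLocus_vanishingIdeal, ← W₂.ofDual.1.2.1.zeroLocus_vanishingIdeal]
  exact zeroLocus_anti_mono h

theorem exists_prime_le_and_notMem {m r : ℕ} {Y : Set (Fin m → ℂ)}
    (g : Fin r → MvPolynomial (Fin m) ℂ) (hg : ∀ y ∈ Y, ∃ ρ, eval y (g ρ) ≠ 0)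
    (Q : Ideal (MvPolynomial (Fin m) ℂ)) [hQ : Q.IsPrime] (hYQ : vanishingIdeal ℂ Y ≤ Q) :
    ∃ P ≤ Q, P.IsPrime ∧ vanishingIdeal ℂ Y ≤ P ∧ ∃ ρ, g ρ ∉ P := by
  by_cases hdisj : ∃ ρ, Disjoint (vanishingIdeal ℂ Y : Set (MvPolynomial (Fin m) ℂ))
      (Q.primeCompl ⊔ Submonoid.powers (g ρ) : Submonoid (MvPolynomial (Fin m) ℂ))
  · obtain ⟨ρ, hρ⟩ := hdisj
    obtain ⟨P, hP, hYP, hPd⟩ := Ideal.exists_le_prime_disjoint _ _ hρ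
    refine ⟨P, fun p hp ↦ ?_, hP, hYP, ρ, fun h ↦ ?_⟩
    · by_contra hpQ
      exact Set.disjoint_left.mp hPd hp (Submonoid.mem_sup_left (S := Q.primeCompl) hpQ)
    · exact Set.disjoint_left.mp hPd h (Submonoid.mem_sup_right (Submonoid.mem_powers _))
  · exfalso
    have hex (ρ) : ∃ h, h ∉ Q ∧ ∀ y ∈ Y, eval y (g ρ) ≠ 0 → eval y h = 0 := by
      obtain ⟨p, hpY, hp⟩ := Set.not_disjoint_iff.mp (not_exists.mp hdisj ρ)
      obtain ⟨h, hh, _, ⟨l, rfl⟩, rfl⟩ := Submonoid.mem_sup.mp hp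
      refine ⟨h, hh, fun y hy hne ↦ ?_⟩
      have : eval y h * eval y (g ρ) ^ l = 0 := by simpa using hpY y hy
      exact (mul_eq_zero.mp this).resolve_right (pow_ne_zero _ hne)
    choose h hhQ hhY using hex
    have hprod : ∏ ρ, h ρ ∈ Q := hYQ fun y hy ↦ by
      obtain ⟨ρ, hρ⟩ := hg y hy
      rw [map_prod]
      exact Finset.prod_eq_zero (Finset.mem_univ ρ) (hhY ρ y hy hρ)
    obtain ⟨ρ, -, hρ⟩ := (hQ.prod_mem_iff).mp hprod
    exact hhQ ρ hρ

theorem ZariskiClosed.exists_fin_generators {m : ℕ} {V : Set (Fin m → ℂ)}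
    (hV : ZariskiClosed V) : ∃ (r : ℕ) (g : Fin r → MvPolynomial (Fin m) ℂ),
      V = {x | ∀ ρ, eval x (g ρ) = 0} := by
  obtain ⟨r, g, hg⟩ := Submodule.fg_iff_exists_fin_generating_family.mp
    (IsNoetherian.noetherian (vanishingIdeal ℂ V))
  refine ⟨r, g, ?_⟩
  conv_lhs => rw [← hV.zeroLocus_vanishingIdeal, ← hg]
  change zeroLocus ℂ (Ideal.span (Set.range g)) = _
  rw [zeroLocus_span]
  ext x
  simp

/-- extension of polynomial maps with fiber-dimension control,
after Jelonek. For `m ≥ n ≥ 1`, a Zariski-closed subvariety `X ⊆ ℂ^m` and a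
polynomial map `f` on `X` (given as the restriction of a polynomial map
`ℂ^m → ℂ^n`), there is a polynomial map `F : ℂ^m → ℂ^n` agreeing with `f` on
`X` such that every fiber of `F`, off `X`, has dimension at most `m - n`. -/
theorem extension_with_small_fibers {m n : ℕ} (hn : 1 ≤ n) (hnm : n ≤ m)
    (X : Set (Fin m → ℂ)) (hX : ZariskiClosed X)
    (f : (Fin m → ℂ) → (Fin n → ℂ)) (hf : IsPolynomialMap f) :
    ∃ F : (Fin m → ℂ) → (Fin n → ℂ), IsPolynomialMap F ∧
      (∀ x ∈ X, F x = f x) ∧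
      ∀ z : Fin n → ℂ, zariskiDim (F ⁻¹' {z} \ X) ≤ ((m - n : ℕ) : WithBot ℕ∞) := by
  obtain ⟨r, g, rfl⟩ := hX.exists_fin_generators
  obtain ⟨p, hp⟩ := hf
  obtain ⟨F, hFp, hF⟩ := exists_generic_perturbation p g
  refine ⟨fun x i ↦ eval x (F i), ⟨F, fun _ _ ↦ rfl⟩, fun x hx ↦ funext fun i ↦ ?_, fun z ↦ ?_⟩
  · rw [hp, ← sub_eq_zero, ← map_sub]
    have hle : Ideal.span (Set.range g) ≤ RingHom.ker (eval x) := by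
      rw [Ideal.span_le]
      rintro _ ⟨ρ, rfl⟩
      exact hx ρ
    exact hle (hFp i)
  refine zariskiDim_le_of_forall_exists_prime fun Q _ hYQ ↦ ?_
  obtain ⟨P, hPQ, hP, hYP, ρ, hρ⟩ := exists_prime_le_and_notMem g
    (fun y hy ↦ not_forall.mp hy.2) Q hYQ
  obtain ⟨d, e, he, hd⟩ := exists_algebraicIndependent_and_ringKrullDim_quotient_le P
  refine ⟨P, hPQ, hd.trans ?_⟩
  obtain rfl | hpos := d.eq_zero_or_pos
  · exact_mod_cast Nat.zero_le _
  have hmk (q : MvPolynomial (Fin m) ℂ) :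
      aeval (fun i ↦ Ideal.Quotient.mk P (MvPolynomial.X i)) q = Ideal.Quotient.mk P q := by
    change _ = Ideal.Quotient.mkₐ ℂ P q
    congr 1
    ext i
    simp
  have hle := hF (MvPolynomial (Fin m) ℂ ⧸ P) (fun i ↦ Ideal.Quotient.mk P (MvPolynomial.X i))
    z d e hpos (fun i ↦ ?_) ⟨ρ, by rwa [hmk, ne_eq, Ideal.Quotient.eq_zero_iff_mem]⟩ he
  · have : d ≤ m - n := by omega
    exact_mod_cast this
  · rw [hmk]
    refine Ideal.Quotient.eq.mpr (hYP fun y hy ↦ ?_ : F i - C (z i) ∈ P)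
    have : (fun i ↦ eval y (F i)) = z := hy.1
    simp [← this]
end

section
/- Let T be an algebraic hypersurface in ℂ^m (the zero set of a nonconstant polynomial), let b ∈ T, and let R ⊆ T be a Zariski-closed subset with dim R ≤ m − 2 and b ∉ R. Then there exists a Zariski-open neighbourhood Z of b in ℂ^m with Z ∩ R = ∅ such that T ∩ Z is biregularly isomorphic to a Zariski-closed algebraic subvariety of ℂ^m; that is, there exist a Zariski-closed set S ⊆ ℂ^m and mutually inverse regular maps T ∩ Z → S and S → T ∩ Z. -/
open MvPolynomial

/-- A map defined on a subset `A ⊆ ℂ^m` with values in `ℂ^k` is regular on `A`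
if it is locally (in the Zariski topology) given by quotients of polynomials
with nonvanishing denominators. -/
def IsRegularOn {m k : ℕ} (f : (Fin m → ℂ) → (Fin k → ℂ)) (A : Set (Fin m → ℂ)) : Prop :=
  ∀ x ∈ A, ∃ U : Set (Fin m → ℂ), ZariskiOpen U ∧ x ∈ U ∧
    ∃ p q : Fin k → MvPolynomial (Fin m) ℂ,
      ∀ y ∈ A ∩ U, ∀ i, eval y (q i) ≠ 0 ∧ f y i = eval y (p i) / eval y (q i)

theorem ringKrullDim_le_of_isIntegral_of_injective {A B : Type*} [CommRing A] [IsDomain A]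
    [CommRing B] [Algebra A B] [Algebra.IsIntegral A B]
    (hinj : Function.Injective (algebraMap A B)) : ringKrullDim A ≤ ringKrullDim B := by
  refine iSup_le fun l => ?_
  obtain ⟨Q, hQ, hQl⟩ := Ideal.exists_ideal_over_prime_of_isIntegral l.head.asIdeal (⊥ : Ideal B)
    (by rw [Ideal.comap_bot_of_injective _ hinj]; exact bot_le)
  have := hQl.1
  have : Q.LiesOver (RelSeries.head l).asIdeal := ⟨hQl.2.symm⟩
  obtain ⟨M, hM, -⟩ := Ideal.exists_ltSeries_of_hasGoingUp l Q
  exact le_iSup_of_le M (by rw [hM])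

theorem natCast_le_ringKrullDim_of_injective {k B : Type} [Field k] [CommRing B] [Algebra k B]
    [Algebra.FiniteType k B] {m : ℕ} (f : MvPolynomial (Fin m) k →ₐ[k] B)
    (hf : Function.Injective f) : (m : WithBot ℕ∞) ≤ ringKrullDim B := by
  obtain ⟨q, hq, hqc⟩ := Ideal.exists_comap_eq_of_mem_minimalPrimes_of_injective
    (f := f.toRingHom) hf ⊥ (by simp [IsDomain.minimalPrimes_eq_singleton_bot])
  refine le_trans ?_ (ringKrullDim_quotient_le q)
  have hinj : Function.Injective ((Ideal.Quotient.mkₐ k q).comp f) := by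
    rw [injective_iff_map_eq_zero]
    intro x hx
    have h : x ∈ q.comap f.toRingHom := by
      simpa [Ideal.Quotient.eq_zero_iff_mem] using hx
    rwa [hqc] at h
  obtain ⟨s, g, hg, hgi⟩ := exists_integral_inj_algHom_of_fg k (B ⧸ q)
  algebraize [g.toRingHom]
  have h1 : (s : WithBot ℕ∞) ≤ ringKrullDim (B ⧸ q) := by
    have := ringKrullDim_le_of_isIntegral_of_injective
      (A := MvPolynomial (Fin s) k) (B := B ⧸ q) hg
    simpa [MvPolynomial.ringKrullDim_of_isNoetherianRing] using this
  refine le_trans ?_ h1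
  have hrange : Algebra.adjoin k (Set.range fun i => g (X i)) = g.range := by
    rw [← Algebra.map_top, ← MvPolynomial.adjoin_range_X, AlgHom.map_adjoin, ← Set.range_comp]
    rfl
  have : Algebra.IsAlgebraic (Algebra.adjoin k (Set.range fun i => g (X i))) (B ⧸ q) := by
    rw [hrange]
    have h : (algebraMap g.range (B ⧸ q)).IsIntegral :=
      RingHom.IsIntegral.tower_top g.rangeRestrict.toRingHom _ hgi
    have : Algebra.IsIntegral g.range (B ⧸ q) := ⟨h⟩
    infer_instance
  have h2 : Algebra.trdeg k (B ⧸ q) ≤ s := by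
    refine (Algebra.IsAlgebraic.trdeg_le_cardinalMk k
      (Set.range fun i => g (X i))).trans (Cardinal.mk_range_le.trans ?_)
    simp
  have h3 := trdeg_le_of_injective _ hinj
  rw [MvPolynomial.trdeg_of_isDomain] at h3
  have h4 := h3.trans h2
  simp only [Cardinal.mk_fin, Cardinal.lift_natCast, Nat.cast_le] at h4
  exact_mod_cast h4

theorem ringKrullDim_le_zariskiDim {m : ℕ} (R : Set (Fin m → ℂ)) :
    ringKrullDim (MvPolynomial (Fin m) ℂ ⧸ vanishingIdeal ℂ R) ≤ zariskiDim R := by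
  set I := vanishingIdeal ℂ R
  let mkI := Ideal.Quotient.mk I
  have key (P : Ideal (MvPolynomial (Fin m) ℂ)) [P.IsPrime] (hIP : I ≤ P) :
      ZariskiClosed (zeroLocus ℂ P) ∧ ZariskiIrreducible (zeroLocus ℂ P) ∧
        zeroLocus ℂ P ⊆ zariskiClosure R := by
    have hv : vanishingIdeal ℂ (zeroLocus ℂ P) = P := by simp
    refine ⟨⟨P, by ext; simp [aeval_eq_eval]⟩, ⟨?_, ?_⟩, ?_⟩
    · rw [Set.nonempty_iff_ne_empty]
      intro h
      rw [h, vanishingIdeal_empty] at hv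
      exact (Ideal.IsPrime.ne_top ‹_›) hv.symm
    · rintro _ _ ⟨S₁, rfl⟩ ⟨S₂, rfl⟩ hsub
      by_contra! hcon
      obtain ⟨h1, h2⟩ := hcon
      simp only [Set.not_subset, Set.mem_ofPred_eq, not_forall] at h1 h2
      obtain ⟨x, hx, p, hp, hpx⟩ := h1
      obtain ⟨y, hy, q, hq, hqy⟩ := h2
      have hpq : p * q ∈ P := by
        rw [← hv]
        intro z hz
        rcases hsub hz with h | h
        · simp [aeval_eq_eval, h p hp]
        · simp [aeval_eq_eval, h q hq]
      rcases Ideal.IsPrime.mem_or_mem ‹_› hpq with h | h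
      · exact hpx (by simpa [aeval_eq_eval] using hx p h)
      · exact hqy (by simpa [aeval_eq_eval] using hy q h)
    · rintro x hx _ ⟨⟨S, rfl⟩, hRS⟩ p hp
      have : p ∈ I := fun r hr => by simpa [aeval_eq_eval] using hRS hr p hp
      simpa [aeval_eq_eval] using hx p (hIP this)
  rw [ringKrullDim, ← Order.krullDim_orderDual]
  refine Order.krullDim_le_of_strictMono
    (fun P => ⟨zeroLocus ℂ ((OrderDual.ofDual P).asIdeal.comap mkI), key _ ?_⟩) ?_
  · exact Ideal.mk_ker.symm.le.trans (Ideal.comap_mono bot_le)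
  · intro P Q hPQ
    have hlt : (OrderDual.ofDual Q).asIdeal < (OrderDual.ofDual P).asIdeal := hPQ
    refine lt_of_le_of_ne (zeroLocus_anti_mono (Ideal.comap_mono hlt.le)) fun h => ?_
    have h' := congrArg (fun C => vanishingIdeal ℂ C.1) h
    simp only [IsPrime.vanishingIdeal_zeroLocus] at h'
    exact hlt.ne' (Ideal.comap_injective_of_surjective _ Ideal.Quotient.mk_surjective h')

theorem false_of_add_two_le_of_le_add_one {d : WithBot ℕ∞} {m : ℕ}
    (h₁ : d + 2 ≤ (m : WithBot ℕ∞)) (h₂ : (m : WithBot ℕ∞) ≤ d + 1) : False := by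
  cases d with
  | bot => simp at h₂
  | coe d =>
    rw [show (2 : WithBot ℕ∞) = ((2 : ℕ∞) : WithBot ℕ∞) from rfl] at h₁
    rw [show (1 : WithBot ℕ∞) = ((1 : ℕ∞) : WithBot ℕ∞) from rfl] at h₂
    rw [← WithBot.coe_add, show (m : WithBot ℕ∞) = ((m : ℕ∞) : WithBot ℕ∞) from rfl,
      WithBot.coe_le_coe] at h₁ h₂
    cases d with
    | top => simp at h₁
    | coe d =>
      norm_cast at h₁ h₂
      omega

/-- The cone with apex `b` over a set of dimension at most `m - 2` lies in a hypersurface. -/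
theorem exists_ne_zero_eval_cone_eq_zero {m : ℕ} (b : Fin m → ℂ) (R : Set (Fin m → ℂ))
    (hRdim : zariskiDim R + 2 ≤ (m : WithBot ℕ∞)) :
    ∃ g : MvPolynomial (Fin m) ℂ, g ≠ 0 ∧
      ∀ r ∈ R, ∀ s : ℂ, eval (b + s • (r - b)) g = 0 := by
  set I := vanishingIdeal ℂ R
  let Φ : MvPolynomial (Fin m) ℂ →ₐ[ℂ] Polynomial (MvPolynomial (Fin m) ℂ ⧸ I) :=
    aeval fun i => algebraMap ℂ _ (b i) +
      Polynomial.X * (Polynomial.C (Ideal.Quotient.mk I (X i)) - algebraMap ℂ _ (b i))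
  have hΦ : ¬ Function.Injective Φ := by
    intro h
    have h1 := natCast_le_ringKrullDim_of_injective (k := ℂ)
      (B := Polynomial (MvPolynomial (Fin m) ℂ ⧸ I)) Φ h
    rw [Polynomial.ringKrullDim_of_isNoetherianRing] at h1
    have h2 := h1.trans (add_le_add_left (ringKrullDim_le_zariskiDim R) 1)
    exact false_of_add_two_le_of_le_add_one hRdim h2
  rw [injective_iff_map_eq_zero] at hΦ
  push Not at hΦ
  obtain ⟨g, hg, hg0⟩ := hΦ
  refine ⟨g, hg0, fun r hr s => ?_⟩
  let ev : (MvPolynomial (Fin m) ℂ ⧸ I) →ₐ[ℂ] ℂ :=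
    Ideal.Quotient.liftₐ I (aeval r) fun p hp => hp r hr
  let evs : Polynomial (MvPolynomial (Fin m) ℂ ⧸ I) →ₐ[ℂ] ℂ :=
    (Polynomial.aeval s).comp (Polynomial.mapAlgHom ev)
  have hcomp : evs.comp Φ = aeval (b + s • (r - b)) := by
    ext i
    simp [evs, Φ, ev]
  have := congrArg evs hg
  rw [map_zero, ← AlgHom.comp_apply, hcomp] at this
  simpa [aeval_eq_eval] using this

/-- A Zariski-closed set and finitely many points off it are separated by one polynomial. -/
theorem ZariskiClosed.exists_eval_ne_zero {m : ℕ} {R : Set (Fin m → ℂ)} (hR : ZariskiClosed R)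
    (s : Finset (Fin m → ℂ)) (hs : ∀ x ∈ s, x ∉ R) :
    ∃ f : MvPolynomial (Fin m) ℂ, (∀ x ∈ R, eval x f = 0) ∧ ∀ x ∈ s, eval x f ≠ 0 := by
  obtain ⟨S, rfl⟩ := hR
  set R := {x : Fin m → ℂ | ∀ p ∈ S, eval x p = 0}
  by_contra! h
  have hsub : (vanishingIdeal ℂ R : Set (MvPolynomial (Fin m) ℂ)) ⊆
      ⋃ x ∈ (s : Set (Fin m → ℂ)), (vanishingIdeal ℂ {x} : Ideal (MvPolynomial (Fin m) ℂ)) := by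
    intro f hf
    obtain ⟨x, hx, hfx⟩ := h f fun x hx => by simpa [aeval_eq_eval] using hf x hx
    simp only [Set.mem_iUnion]
    exact ⟨x, hx, by simpa [mem_vanishingIdeal_singleton_iff, aeval_eq_eval] using hfx⟩
  rw [Ideal.subset_union_prime 0 0 fun _ _ _ _ => inferInstance] at hsub
  obtain ⟨x, hx, hle⟩ := hsub
  refine hs x hx fun p hp => ?_
  have : p ∈ vanishingIdeal ℂ R := fun y hy => by simpa [aeval_eq_eval] using hy p hp
  simpa [mem_vanishingIdeal_singleton_iff, aeval_eq_eval] using hle this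

theorem natDegree_prod_le_and_coeff_prod {A ι : Type*} [CommSemiring A] (s : Finset ι)
    (f : ι → Polynomial A) (n : ι → ℕ) (h : ∀ i ∈ s, (f i).natDegree ≤ n i) :
    (∏ i ∈ s, f i).natDegree ≤ ∑ i ∈ s, n i ∧
      (∏ i ∈ s, f i).coeff (∑ i ∈ s, n i) = ∏ i ∈ s, (f i).coeff (n i) := by
  classical
  induction s using Finset.induction_on with
  | empty => simp
  | insert a s ha ih =>
    obtain ⟨h1, h2⟩ := ih fun i hi => h i (Finset.mem_insert_of_mem hi)
    have h3 := h a (Finset.mem_insert_self _ _)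
    rw [Finset.prod_insert ha, Finset.sum_insert ha, Finset.prod_insert ha]
    exact ⟨Polynomial.natDegree_mul_le_of_le h3 h1,
      by rw [Polynomial.coeff_mul_add_eq_of_natDegree_le h3 h1, h2]⟩

/-- Restricting a form of degree `n` to the line `x + t w` gives a polynomial in `t` of degree at
most `n`, whose coefficient in degree `n` is the value of the form at `w`. -/
theorem natDegree_le_and_coeff_line_of_isHomogeneous {k A σ : Type*} [CommRing k]
    [CommRing A] [Algebra k A] {φ : MvPolynomial σ k} {n : ℕ} (hφ : φ.IsHomogeneous n)
    (x w : σ → A) :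
    (aeval (fun i => Polynomial.C (x i) + Polynomial.C (w i) * Polynomial.X) φ).natDegree ≤ n ∧
      (aeval (fun i => Polynomial.C (x i) + Polynomial.C (w i) * Polynomial.X) φ).coeff n =
        aeval w φ := by
  set l : σ → Polynomial A := fun i => Polynomial.C (x i) + Polynomial.C (w i) * Polynomial.X
  have hl (i : σ) : (l i).natDegree ≤ 1 := by
    simp only [l]; compute_degree
  have hmon (d : σ →₀ ℕ) (hd : d ∈ φ.support) :
      (∏ i ∈ d.support, l i ^ d i).natDegree ≤ n ∧
      (∏ i ∈ d.support, l i ^ d i).coeff n = ∏ i ∈ d.support, w i ^ d i := by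
    have hdn : ∑ i ∈ d.support, d i = n := (hφ.degree_eq_sum_deg_support hd).symm
    have := natDegree_prod_le_and_coeff_prod d.support (fun i => l i ^ d i) d fun i _ => by
      simpa using Polynomial.natDegree_pow_le_of_le (d i) (hl i)
    rw [hdn] at this
    refine ⟨this.1, this.2.trans (Finset.prod_congr rfl fun i _ => ?_)⟩
    have := Polynomial.coeff_pow_of_natDegree_le (m := d i) (hl i)
    rw [mul_one] at this
    rw [this]
    simp [l]
  have hsum (A' : Type _) [CommRing A'] [Algebra k A'] (y : σ → A') :
      aeval y φ = ∑ d ∈ φ.support, algebraMap k A' (φ.coeff d) * ∏ i ∈ d.support, y i ^ d i := by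
    rw [aeval_def, eval₂_eq]
  rw [hsum _ l, hsum _ w]
  constructor
  · refine Polynomial.natDegree_sum_le_of_forall_le _ _ fun d hd => ?_
    rw [Polynomial.algebraMap_apply]
    exact (Polynomial.natDegree_C_mul_le _ _).trans (hmon d hd).1
  · rw [Polynomial.finsetSum_coeff]
    refine Finset.sum_congr rfl fun d hd => ?_
    rw [Polynomial.algebraMap_apply, Polynomial.coeff_C_mul, (hmon d hd).2]

theorem natDegree_le_and_coeff_line {k A σ : Type*} [CommRing k]
    [CommRing A] [Algebra k A] (φ : MvPolynomial σ k) (x w : σ → A) :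
    (aeval (fun i => Polynomial.C (x i) + Polynomial.C (w i) * Polynomial.X) φ).natDegree ≤
        φ.totalDegree ∧
      (aeval (fun i => Polynomial.C (x i) + Polynomial.C (w i) * Polynomial.X) φ).coeff
        φ.totalDegree = aeval w (homogeneousComponent φ.totalDegree φ) := by
  set l : σ → Polynomial A := fun i => Polynomial.C (x i) + Polynomial.C (w i) * Polynomial.X
  have h (j : ℕ) := natDegree_le_and_coeff_line_of_isHomogeneous
    (homogeneousComponent_isHomogeneous j φ) x w
  have hsum : aeval l φ = ∑ j ∈ Finset.range (φ.totalDegree + 1),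
      aeval l (homogeneousComponent j φ) := by
    conv_lhs => rw [← sum_homogeneousComponent φ, map_sum]
  constructor
  · rw [hsum]
    refine Polynomial.natDegree_sum_le_of_forall_le _ _ fun j hj => (h j).1.trans ?_
    exact Nat.lt_succ_iff.1 (Finset.mem_range.1 hj)
  · rw [hsum, Polynomial.finsetSum_coeff, Finset.sum_range_succ, (h _).2, Finset.sum_eq_zero,
      zero_add]
    exact fun j hj => Polynomial.coeff_eq_zero_of_natDegree_lt
      ((h j).1.trans_lt (Finset.mem_range.1 hj))

theorem eval_aeval {k σ τ : Type*} [CommRing k] (y : τ → k) (u : σ → MvPolynomial τ k)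
    (f : MvPolynomial σ k) : eval y (aeval u f) = eval (fun i => eval y (u i)) f := by
  have h : (aeval y : MvPolynomial τ k →ₐ[k] k).comp (aeval u) =
      aeval fun i => eval y (u i) := by
    ext i
    simp [aeval_eq_eval]
  exact DFunLike.congr_fun h f

/-- If the line through `c` in direction `v` misses `R`, some polynomial vanishes at every point
whose parallel line meets `R`, but not at `c`. -/
theorem exists_eval_eq_zero_of_line_meets {m : ℕ} {p : MvPolynomial (Fin m) ℂ}
    (hp : 0 < p.totalDegree) {v : Fin m → ℂ}
    (hv : eval v (homogeneousComponent p.totalDegree p) ≠ 0) {R : Set (Fin m → ℂ)}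
    (hR : ZariskiClosed R) (hRp : ∀ x ∈ R, eval x p = 0) {c : Fin m → ℂ}
    (hc : ∀ t : ℂ, c + t • v ∉ R) :
    ∃ H : MvPolynomial (Fin m) ℂ, eval c H ≠ 0 ∧ ∀ x, ∀ t : ℂ, x + t • v ∈ R → eval x H = 0 := by
  classical
  let lx (x : Fin m → ℂ) : MvPolynomial (Fin m) ℂ →ₐ[ℂ] Polynomial ℂ :=
    aeval fun i => Polynomial.C (x i) + Polynomial.C (v i) * Polynomial.X
  let l : MvPolynomial (Fin m) ℂ →ₐ[ℂ] Polynomial (MvPolynomial (Fin m) ℂ) :=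
    aeval fun i => Polynomial.C (X i) + Polynomial.C (C (v i)) * Polynomial.X
  have hlx (f : MvPolynomial (Fin m) ℂ) (x : Fin m → ℂ) (t : ℂ) :
        (lx x f).eval t = eval (x + t • v) f := by
    have : (Polynomial.aeval t).comp (lx x) = aeval (x + t • v) := by
      ext i
      simp only [lx, AlgHom.comp_apply, aeval_X, Polynomial.coe_aeval_eq_eval,
        Polynomial.eval_add, Polynomial.eval_mul, Polynomial.eval_C, Polynomial.eval_X,
        Pi.add_apply, Pi.smul_apply, smul_eq_mul, mul_comm]
    exact DFunLike.congr_fun this f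
  have hl (f : MvPolynomial (Fin m) ℂ) (x : Fin m → ℂ) : (l f).map (eval x) = lx x f := by
    have : (Polynomial.mapAlgHom (aeval x)).comp l = lx x := by
      ext i : 1
      simp [l, lx]
    exact DFunLike.congr_fun this f
  have hdeg (x : Fin m → ℂ) : (lx x p).natDegree ≤ p.totalDegree :=
    (natDegree_le_and_coeff_line p x v).1
  have hcoeff (x : Fin m → ℂ) : (lx x p).coeff p.totalDegree ≠ 0 := by
    rw [(natDegree_le_and_coeff_line p x v).2]
    simpa [aeval_eq_eval] using hv
  have hne : lx c p ≠ 0 := fun h => hcoeff c (by simp [h])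
  obtain ⟨f, hfR, hf⟩ := hR.exists_eval_ne_zero ((lx c p).roots.toFinset.image fun t => c + t • v)
    (by simp only [Finset.mem_image]; rintro _ ⟨t, -, rfl⟩; exact hc t)
  have hlp : (l p).natDegree ≤ p.totalDegree :=
    (natDegree_le_and_coeff_line p (fun i => (X i : MvPolynomial (Fin m) ℂ)) fun i => C (v i)).1
  refine ⟨(l p).resultant (l f) p.totalDegree (l f).natDegree, ?_, fun x t hxt => ?_⟩
  · rw [← Polynomial.resultant_map_map, hl, hl]
    have hnat : (lx c p).natDegree = p.totalDegree :=
      (hdeg c).antisymm (Polynomial.le_natDegree_of_ne_zero (hcoeff c))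
    have hle : (lx c f).natDegree ≤ (l f).natDegree := by
      rw [← hl]; exact Polynomial.natDegree_map_le
    obtain ⟨k, hk⟩ := Nat.exists_eq_add_of_le hle
    rw [hk, Polynomial.resultant_add_right_deg _ _ _ _ _ le_rfl]
    refine mul_ne_zero (pow_ne_zero _ (hcoeff c)) ?_
    rw [← hnat]
    refine Polynomial.resultant_ne_zero _ _ ?_
    rw [Polynomial.isCoprime_iff_aeval_ne_zero_of_isAlgClosed ℂ ℂ]
    intro t
    by_cases ht : (lx c p).eval t = 0
    · right
      have := hf (c + t • v) (Finset.mem_image_of_mem _ (by simpa using ⟨hne, ht⟩))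
      simpa [hlx] using this
    · left
      simpa using ht
  · obtain ⟨a, a', -, -, h⟩ := Polynomial.exists_mul_add_mul_eq_C_resultant (l p) (l f) hlp le_rfl
      (Or.inl hp.ne')
    have := congrArg (fun F => (F.map (eval x)).eval t) h
    simpa [Polynomial.map_mul, hl, hlx, hRp _ hxt, hfR _ hxt] using this.symm

theorem MvPolynomial.IsHomogeneous.eval_smul_eq {k σ : Type*} [CommRing k] {φ : MvPolynomial σ k}
    {n : ℕ} (hφ : φ.IsHomogeneous n) (c : k) (w : σ → k) :
    eval (c • w) φ = c ^ n * eval w φ := by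
  rw [eval_eq, eval_eq, Finset.mul_sum]
  refine Finset.sum_congr rfl fun d hd => ?_
  simp only [Pi.smul_apply, smul_eq_mul, mul_pow, Finset.prod_mul_distrib,
    Finset.prod_pow_eq_pow_sum]
  rw [hφ.degree_eq_sum_deg_support hd]
  ring

/-- Clearing denominators in `p (u + s⁻¹ v)`. -/
theorem exists_eval_eq_pow_mul_eval_add_inv_smul {k σ : Type*} [Field k] (p : MvPolynomial σ k)
    (s : MvPolynomial σ k) (u : σ → MvPolynomial σ k) (v : σ → k) :
    ∃ q : MvPolynomial σ k, ∀ y,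
      (eval y s = 0 → eval y q = eval v (homogeneousComponent p.totalDegree p)) ∧
      (eval y s ≠ 0 → eval y q = eval y s ^ p.totalDegree *
        eval ((fun i => eval y (u i)) + (eval y s)⁻¹ • v) p) := by
  set d := p.totalDegree
  refine ⟨∑ j ∈ Finset.range (d + 1),
    s ^ (d - j) * aeval (fun i => s * u i + C (v i)) (homogeneousComponent j p), fun y => ?_⟩
  have hq : eval y (∑ j ∈ Finset.range (d + 1),
      s ^ (d - j) * aeval (fun i => s * u i + C (v i)) (homogeneousComponent j p)) =
      ∑ j ∈ Finset.range (d + 1), eval y s ^ (d - j) *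
        eval (eval y s • (fun i => eval y (u i)) + v) (homogeneousComponent j p) := by
    have h : (fun i => eval y (s * u i + C (v i))) =
        eval y s • (fun i => eval y (u i)) + v := by
      funext i
      simp
    simp only [map_sum, map_mul, map_pow, eval_aeval, h]
  rw [hq]
  constructor
  · intro hs
    rw [Finset.sum_range_succ, Finset.sum_eq_zero]
    · simp [hs]
    · intro j hj
      have : d - j ≠ 0 := Nat.sub_ne_zero_of_lt (Finset.mem_range.1 hj)
      simp [hs, this]
  · intro hs
    conv_rhs => rw [← sum_homogeneousComponent p, map_sum, Finset.mul_sum]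
    refine Finset.sum_congr rfl fun j hj => ?_
    have hj' : j ≤ d := Nat.lt_succ_iff.1 (Finset.mem_range.1 hj)
    have hz : eval y s • (fun i => eval y (u i)) + v =
        eval y s • ((fun i => eval y (u i)) + (eval y s)⁻¹ • v) := by
      rw [smul_add, smul_inv_smul₀ hs]
    rw [hz, (homogeneousComponent_isHomogeneous j p).eval_smul_eq, ← mul_assoc, ← pow_add,
      Nat.sub_add_cancel hj']

theorem homogeneousComponent_totalDegree_ne_zero {k σ : Type*} [CommRing k] {p : MvPolynomial σ k}
    (hp : p ≠ 0) : homogeneousComponent p.totalDegree p ≠ 0 := by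
  obtain ⟨d, hd, hdeg⟩ := Finset.exists_mem_eq_sup p.support (support_nonempty.2 hp)
    fun s => s.degree
  have htot : p.totalDegree = d.degree := by
    rw [← hdeg, totalDegree]; rfl
  intro h
  have := congrArg (coeff d) h
  rw [coeff_homogeneousComponent, if_pos htot.symm, coeff_zero] at this
  exact mem_support_iff.1 hd this

/-- If `dim R ≤ m - 2`, some line through `b ∉ R`, transverse to `p` at infinity, misses `R`. -/
theorem exists_direction {m : ℕ} {p : MvPolynomial (Fin m) ℂ} (hp : p ≠ 0) {b : Fin m → ℂ}
    {R : Set (Fin m → ℂ)} (hRdim : zariskiDim R + 2 ≤ (m : WithBot ℕ∞)) (hbR : b ∉ R) :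
    ∃ v, eval v (homogeneousComponent p.totalDegree p) ≠ 0 ∧ ∀ t : ℂ, b + t • v ∉ R := by
  obtain ⟨g, hg, hgR⟩ := exists_ne_zero_eval_cone_eq_zero b R hRdim
  let g' : MvPolynomial (Fin m) ℂ := aeval (fun i => C (b i) + X i) g
  have hg' (v : Fin m → ℂ) : eval v g' = eval (b + v) g := by
    have h : (fun i => eval v (C (b i) + X i)) = b + v := by
      funext i
      simp
    rw [eval_aeval, h]
  have hg0 : g' ≠ 0 := by
    intro h
    refine hg (MvPolynomial.funext fun x => ?_)
    have := hg' (x - b)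
    rw [h] at this
    simpa using this.symm
  obtain ⟨v, hv⟩ : ∃ v, eval v (homogeneousComponent p.totalDegree p * g') ≠ 0 := by
    by_contra! h
    exact mul_ne_zero (homogeneousComponent_totalDegree_ne_zero hp) hg0
      (MvPolynomial.funext fun x => by simpa using h x)
  rw [map_mul, mul_ne_zero_iff, hg'] at hv
  refine ⟨v, hv.1, fun t ht => ?_⟩
  rcases eq_or_ne t 0 with rfl | h0
  · exact hbR (by simpa using ht)
  · refine hv.2 ?_
    have := hgR _ ht t⁻¹
    rwa [add_sub_cancel_left, inv_smul_smul₀ h0] at this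

/-- after Jelonek. Let `T` be an algebraic hypersurface in
`ℂ^m` (the zero set of a nonconstant polynomial), `b ∈ T`, and `R ⊆ T` a
Zariski-closed subset of dimension at most `m - 2` with `b ∉ R`. Then `b` has
a Zariski-open neighbourhood `Z` in `ℂ^m`, disjoint from `R`, such that
`T ∩ Z` is biregularly isomorphic to a Zariski-closed subvariety of `ℂ^m`. -/
theorem hypersurface_locally_embeds_as_closed_subvariety {m : ℕ}
    (p : MvPolynomial (Fin m) ℂ) (hp : 0 < p.totalDegree)
    (T : Set (Fin m → ℂ)) (hT : T = {x | eval x p = 0})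
    (b : Fin m → ℂ) (hb : b ∈ T)
    (R : Set (Fin m → ℂ)) (hRT : R ⊆ T) (hRclosed : ZariskiClosed R)
    (hRdim : zariskiDim R + 2 ≤ (m : WithBot ℕ∞)) (hbR : b ∉ R) :
    ∃ Z : Set (Fin m → ℂ), ZariskiOpen Z ∧ b ∈ Z ∧ Z ∩ R = ∅ ∧
      ∃ S : Set (Fin m → ℂ), ZariskiClosed S ∧
        ∃ φ ψ : (Fin m → ℂ) → (Fin m → ℂ),
          IsRegularOn φ (T ∩ Z) ∧ IsRegularOn ψ S ∧
          Set.MapsTo φ (T ∩ Z) S ∧ Set.MapsTo ψ S (T ∩ Z) ∧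
          (∀ x ∈ T ∩ Z, ψ (φ x) = x) ∧ (∀ y ∈ S, φ (ψ y) = y) := by
  subst hT
  have hp0 : p ≠ 0 := by rintro rfl; simp at hp
  obtain ⟨v, hv, hvR⟩ := exists_direction hp0 hRdim hbR
  obtain ⟨i₀, hi₀⟩ : ∃ i, v i ≠ 0 := by
    by_contra! h
    have hv0 : v = (0 : ℂ) • v := by ext i; simp [h i]
    rw [hv0, (homogeneousComponent_isHomogeneous _ p).eval_smul_eq, zero_pow hp.ne', zero_mul] at hv
    exact hv rfl
  obtain ⟨H, hHb, hHR⟩ := exists_eval_eq_zero_of_line_meets hp hv hRclosed (fun x hx => hRT hx)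
    (c := b - v) fun t ht => hvR (t - 1) (by convert ht using 1; module)
  let Λ : MvPolynomial (Fin m) ℂ := 1 + C (v i₀)⁻¹ * (X i₀ - C (b i₀))
  let u (i : Fin m) : MvPolynomial (Fin m) ℂ := X i - Λ * C (v i)
  let h : MvPolynomial (Fin m) ℂ := aeval u H
  let s : MvPolynomial (Fin m) ℂ := h * Λ
  obtain ⟨q, hq⟩ := exists_eval_eq_pow_mul_eval_add_inv_smul p s u v
  have hu (y : Fin m → ℂ) : (fun i => eval y (u i)) = y - eval y Λ • v := by
    ext i; simp [u]
  have hh (y : Fin m → ℂ) : eval y h = eval (y - eval y Λ • v) H := by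
    rw [eval_aeval, hu]
  have hΛ (y : Fin m → ℂ) (t : ℂ) : eval (y + t • v) Λ = eval y Λ + t := by
    simp [Λ]; field_simp; ring
  let φ (y : Fin m → ℂ) : Fin m → ℂ := y - eval y Λ • v + (eval y s)⁻¹ • v
  have hφΛ (y) : eval (φ y) Λ = (eval y s)⁻¹ := by
    have : φ y = y + ((eval y s)⁻¹ - eval y Λ) • v := by simp only [φ]; module
    rw [this, hΛ]; ring
  have hφu (y) : φ y - eval (φ y) Λ • v = y - eval y Λ • v := by
    rw [hφΛ]; simp only [φ]; module
  have hφs (y) : eval (φ y) s = eval y h * (eval y s)⁻¹ := by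
    simp only [s, map_mul]
    rw [hh, hφu, ← hh, hφΛ]
    simp [s]
  have hs (y) : eval y s = eval y h * eval y Λ := by simp [s]
  have hφφ (y) (hy : eval y s ≠ 0) : φ (φ y) = y := by
    have : (eval (φ y) s)⁻¹ = eval y Λ := by
      rw [hs] at hy
      obtain ⟨h1, h2⟩ := mul_ne_zero_iff.1 hy
      rw [hφs, hs]; field_simp
    rw [show φ (φ y) = (φ y - eval (φ y) Λ • v) + (eval (φ y) s)⁻¹ • v from rfl, this, hφu]
    module
  have hφs0 (y) (hy : eval y s ≠ 0) : eval (φ y) s ≠ 0 := by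
    have hh0 : eval y h ≠ 0 := fun h0 => hy (by rw [hs, h0, zero_mul])
    rw [hφs]
    exact mul_ne_zero hh0 (inv_ne_zero hy)
  have hqφ (y) (hy : eval y s ≠ 0) : eval y q = eval y s ^ p.totalDegree * eval (φ y) p := by
    rw [(hq y).2 hy, hu]
  have hqs (y) (hy : eval y q = 0) : eval y s ≠ 0 := fun h0 => hv (((hq y).1 h0).symm.trans hy)
  have hreg (A : Set (Fin m → ℂ)) (hA : ∀ y ∈ A, eval y s ≠ 0) : IsRegularOn φ A := by
    refine fun x _ => ⟨Set.univ, ⟨{1}, by ext; simp⟩, trivial, fun i => s * u i + C (v i),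
      fun _ => s, fun y hy i => ⟨hA y hy.1, ?_⟩⟩
    have h0 := hA y hy.1
    have hui : eval y (u i) = y i - eval y Λ * v i := by simp [u]
    simp only [map_add, map_mul, eval_C, hui, φ, Pi.add_apply, Pi.sub_apply, Pi.smul_apply,
      smul_eq_mul]
    field_simp
  refine ⟨{x | eval x s ≠ 0}, ⟨{s}, by ext; simp⟩, ?_, ?_, {y | eval y q = 0}, ⟨{q}, by simp⟩, φ, φ,
    hreg _ fun y hy => hy.2, hreg _ hqs, ?_, ?_, fun x hx => hφφ x hx.2,
    fun y hy => hφφ y (hqs y hy)⟩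
  · have : eval b Λ = 1 := by simp [Λ]
    simpa [hs, hh, this] using hHb
  · rw [Set.eq_empty_iff_forall_notMem]
    rintro x ⟨hxs, hxR⟩
    refine hxs ?_
    rw [hs, hh, hHR _ (eval x Λ) (by simpa using hxR), zero_mul]
  · rintro x ⟨hxp, hxs⟩
    have hxp' : eval x p = 0 := hxp
    simp [hqφ _ (hφs0 x hxs), hφφ x hxs, hxp']
  · intro y hy
    have hys := hqs y hy
    refine ⟨?_, hφs0 y hys⟩
    have hyq : eval y q = 0 := hy
    rw [hqφ y hys] at hyq
    exact (mul_eq_zero.1 hyq).resolve_left (pow_ne_zero _ hys)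
end
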